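/- Let 0 < ε₁ < ε₂ < 1 and let f be a smooth function compactly supported in B_{ε₁,ε₂} ∩ U, where U = {x₃ > 0}. Let ε₁ ≤ ε ≤ ε₂ and δ = (1−ε²)/(2ε). If the spindle transform 𝒮f(r,α,β) = 0 for all r ∈ [0,δ], α ∈ [0,2π], β ∈ [0,π], then f(x) = 0 for all x with ε ≤ |x| ≤ 1. -/

import Mathlib

noncomputable section
open Real MeasureTheory Set

abbrev R3 := EuclideanSpace ℝ (Fin 3)

/-- The unit vector with spherical angles `θ` (azimuth) and `φ` (colatitude). -/
def sphVec (θ φ : ℝ) : R3 :=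
  (WithLp.equiv 2 (Fin 3 → ℝ)).symm ![sin φ * cos θ, sin φ * sin θ, cos φ]

/-- Rotation about the `x₃` axis by angle `α`. -/
def rotZ (α : ℝ) (x : R3) : R3 :=
  (WithLp.equiv 2 (Fin 3 → ℝ)).symm
    ![cos α * x 0 - sin α * x 1, sin α * x 0 + cos α * x 1, x 2]

/-- Rotation about the `x₂` axis by angle `β`. -/
def rotY (β : ℝ) (x : R3) : R3 :=
  (WithLp.equiv 2 (Fin 3 → ℝ)).symm
    ![cos β * x 0 + sin β * x 2, x 1, -sin β * x 0 + cos β * x 2]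

/-- `h = U(α)V(β)`. -/
def rotUV (α β : ℝ) (x : R3) : R3 := rotZ α (rotY β x)

/-- The hollow ball `B_{a,b} = {x ∈ ℝ³ : a < |x| < b}`. -/
def hollowBall (a b : ℝ) : Set R3 := {x : R3 | a < ‖x‖ ∧ ‖x‖ < b}

/-- The open upper half space `U = {x₃ > 0}`. -/
def upperHalf : Set R3 := {x : R3 | 0 < x 2}

/-- The spindle transform `𝒮f`. -/
def spindleT (f : R3 → ℝ) (r α β : ℝ) : ℝ :=
  ∫ θ in (0:ℝ)..(2 * π), ∫ φ in (0:ℝ)..π,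
    (Real.sqrt (r ^ 2 * sin φ ^ 2 + 1) - r * sin φ) ^ 2 * sin φ *
      Real.sqrt ((1 + r ^ 2) / (1 + r ^ 2 * sin φ ^ 2)) *
      f ((Real.sqrt (r ^ 2 * sin φ ^ 2 + 1) - r * sin φ) • rotUV α β (sphVec θ φ))

open scoped ENNReal

@[fun_prop] lemma continuous_sphVec_comp {X : Type*} [TopologicalSpace X] {u v : X → ℝ}
    (hu : Continuous u) (hv : Continuous v) : Continuous fun x => sphVec (u x) (v x) := by
  unfold sphVec
  refine (PiLp.continuous_toLp 2 _).comp (continuous_pi fun i => ?_)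
  fin_cases i <;> simp <;> fun_prop

lemma sphVec_continuous : Continuous (fun p : ℝ × ℝ => sphVec p.1 p.2) := by fun_prop

@[simp] lemma sphVec_zero (θ φ : ℝ) : sphVec θ φ 0 = sin φ * cos θ := rfl
@[simp] lemma sphVec_one (θ φ : ℝ) : sphVec θ φ 1 = sin φ * sin θ := rfl
@[simp] lemma sphVec_two (θ φ : ℝ) : sphVec θ φ 2 = cos φ := rfl

lemma norm_sphVec (θ φ : ℝ) : ‖sphVec θ φ‖ = 1 := by
  rw [EuclideanSpace.norm_eq, Real.sqrt_eq_one]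
  simp only [Fin.sum_univ_three, sphVec_zero, sphVec_one, sphVec_two, Real.norm_eq_abs, sq_abs]
  nlinarith [sin_sq_add_cos_sq θ, sin_sq_add_cos_sq φ]

/-- Cylindrical coordinates on `ℝ³` for the Lebesgue integral. -/
lemma lintegral_R3_eq (g : R3 → ℝ≥0∞) (hg : Measurable g) :
    ∫⁻ x, g x = ∫⁻ z : ℝ, ∫⁻ p : ℝ × ℝ, g !₂[p.1, p.2, z] := by
  rw [← (PiLp.volume_preserving_toLp (Fin 3)).lintegral_comp hg]
  have h1 := (volume_preserving_piFinSuccAbove (fun _ : Fin 3 => ℝ) 2).symm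
  rw [← h1.lintegral_comp (by fun_prop), Measure.volume_eq_prod, lintegral_prod _ (by fun_prop)]
  refine lintegral_congr fun z => ?_
  have h2 := (volume_preserving_finTwoArrow ℝ).symm
  rw [← h2.lintegral_comp (by fun_prop)]
  refine lintegral_congr fun p => ?_
  congr 2
  ext i
  fin_cases i <;>
    simp [MeasurableEquiv.piFinSuccAbove, MeasurableEquiv.finTwoArrow, Fin.insertNthEquiv] <;> rfl

/-- Spherical coordinates on `ℝ³` for the Lebesgue integral. -/
lemma lintegral_spherical (g : R3 → ℝ≥0∞) (hg : Measurable g) :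
    ∫⁻ x, g x = ∫⁻ θ in Ioo (-π) π, ∫⁻ ρ in Ioi (0:ℝ), ∫⁻ φ in Ioo 0 π,
      ENNReal.ofReal (ρ ^ 2 * sin φ) * g (ρ • sphVec θ φ) := by
  have hm : Measurable (fun q : (ℝ × ℝ) × ℝ => g !₂[q.1.1, q.1.2, q.2]) := by
    refine hg.comp ((PiLp.continuous_toLp 2 _).comp (continuous_pi fun i => ?_)).measurable
    fin_cases i <;> simp <;> fun_prop
  rw [lintegral_R3_eq g hg]
  have e1 : ∀ z : ℝ, ∫⁻ p : ℝ × ℝ, g !₂[p.1, p.2, z] =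
      ∫⁻ θ in Ioo (-π) π, ∫⁻ s in Ioi (0:ℝ), ENNReal.ofReal s * g !₂[s * cos θ, s * sin θ, z] := by
    intro z
    rw [← lintegral_comp_polarCoord_symm, polarCoord_target, Measure.volume_eq_prod,
      ← Measure.prod_restrict, lintegral_prod_symm]
    · simp [polarCoord_symm_apply]
    · refine Measurable.aemeasurable (Measurable.mul (by fun_prop) ?_)
      exact hm.comp ((continuous_polarCoord_symm.measurable).prodMk measurable_const)
  simp_rw [e1]
  rw [lintegral_lintegral_swap]
  swap
  · refine Measurable.aemeasurable ?_
    refine Measurable.lintegral_prod_right' (f := fun q : (ℝ × ℝ) × ℝ =>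
      ENNReal.ofReal q.2 * g !₂[q.2 * cos q.1.2, q.2 * sin q.1.2, q.1.1]) ?_
    refine Measurable.mul (by fun_prop) ?_
    exact hm.comp (g := fun q : (ℝ × ℝ) × ℝ => g !₂[q.1.1, q.1.2, q.2])
      (f := fun q : (ℝ × ℝ) × ℝ => ((q.2 * cos q.1.2, q.2 * sin q.1.2), q.1.1)) (by fun_prop)
  refine lintegral_congr fun θ => ?_
  have hm' : Measurable (fun p : ℝ × ℝ => (Ioi (0:ℝ)).indicator
      (fun s => ENNReal.ofReal s * g !₂[s * cos θ, s * sin θ, p.1]) p.2) := by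
    have : (fun p : ℝ × ℝ => (Ioi (0:ℝ)).indicator
      (fun s => ENNReal.ofReal s * g !₂[s * cos θ, s * sin θ, p.1]) p.2) =
      (Prod.snd ⁻¹' Ioi (0:ℝ)).indicator
      (fun p : ℝ × ℝ => ENNReal.ofReal p.2 * g !₂[p.2 * cos θ, p.2 * sin θ, p.1]) := by
      ext p; simp [indicator]
    rw [this]
    refine Measurable.indicator (Measurable.mul (by fun_prop) ?_)
      (measurableSet_Ioi.preimage measurable_snd)
    exact hm.comp (g := fun q : (ℝ × ℝ) × ℝ => g !₂[q.1.1, q.1.2, q.2])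
      (f := fun q : ℝ × ℝ => ((q.2 * cos θ, q.2 * sin θ), q.1)) (by fun_prop)
  have e2 : ∀ z : ℝ, ∫⁻ s in Ioi (0:ℝ), ENNReal.ofReal s * g !₂[s * cos θ, s * sin θ, z] =
      ∫⁻ s, (Ioi (0:ℝ)).indicator
        (fun s => ENNReal.ofReal s * g !₂[s * cos θ, s * sin θ, z]) s := by
    intro z; rw [lintegral_indicator measurableSet_Ioi]
  simp_rw [e2]
  rw [← lintegral_prod (fun p : ℝ × ℝ => (Ioi (0:ℝ)).indicator
      (fun s => ENNReal.ofReal s * g !₂[s * cos θ, s * sin θ, p.1]) p.2) hm'.aemeasurable,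
    ← Measure.volume_eq_prod, ← lintegral_comp_polarCoord_symm, polarCoord_target,
    Measure.volume_eq_prod, ← Measure.prod_restrict, lintegral_prod]
  swap
  · refine Measurable.aemeasurable (Measurable.mul (by fun_prop) ?_)
    exact hm'.comp continuous_polarCoord_symm.measurable
  refine setLIntegral_congr_fun measurableSet_Ioi fun ρ hρ => ?_
  have hsub : Ioo 0 π ⊆ Ioo (-π) π := fun x hx => ⟨by linarith [pi_pos, hx.1], hx.2⟩
  rw [← inter_eq_left.2 hsub, ← setLIntegral_indicator measurableSet_Ioo]
  refine setLIntegral_congr_fun measurableSet_Ioo fun φ hφ => ?_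
  have hρ' : 0 < ρ := hρ
  simp only [polarCoord_symm_apply, indicator, mem_Ioi, mem_Ioo, smul_eq_mul]
  by_cases h : 0 < φ
  · have hs : 0 < sin φ := sin_pos_of_pos_of_lt_pi h hφ.2
    rw [if_pos (by positivity), if_pos ⟨h, hφ.2⟩, ← mul_assoc, ← ENNReal.ofReal_mul hρ'.le]
    congr 2
    · ring
    · ext i
      fin_cases i <;> simp <;> ring
  · have hs : sin φ ≤ 0 := sin_nonpos_of_nonpos_of_neg_pi_le (not_lt.1 h) hφ.1.le
    rw [if_neg (by nlinarith), if_neg (by tauto), mul_zero]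

/-- Expansion of `∫ (A cos θ + B)^{2m} dθ` in even powers of `A` and `B`. -/
lemma integral_cos_add_pow (m : ℕ) (A B : ℝ) :
    ∫ θ in (0:ℝ)..(2 * π), (A * cos θ + B) ^ (2 * m) =
      ∑ i ∈ Finset.range (m + 1), ((2 * m).choose (2 * i) * ∫ θ in (0:ℝ)..(2 * π), cos θ ^ (2 * i)) *
        ((A ^ 2) ^ i * (B ^ 2) ^ (m - i)) := by
  have hs : ∀ (n : ℕ) (h : ℕ → ℝ), (∀ i, h (2 * i + 1) = 0) →
      ∑ l ∈ Finset.range (2 * n + 1), h l = ∑ i ∈ Finset.range (n + 1), h (2 * i) := by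
    intro n h h0
    induction n with
    | zero => simp
    | succ k ih =>
      rw [show 2 * (k + 1) + 1 = 2 * k + 1 + 1 + 1 by ring, Finset.sum_range_succ,
        Finset.sum_range_succ, ih, h0, Finset.sum_range_succ _ (k + 1)]
      ring_nf
  have hodd : ∀ i : ℕ, ∫ θ in (0:ℝ)..(2 * π), cos θ ^ (2 * i + 1) = 0 := by
    intro i
    have := integral_sin_pow_mul_cos_pow_odd (a := 0) (b := 2 * π) 0 i
    simpa using this
  simp_rw [add_pow]
  rw [intervalIntegral.integral_finsetSum fun i _ =>
    Continuous.intervalIntegrable (by fun_prop) _ _]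
  have e : ∀ l, ∫ θ in (0:ℝ)..(2 * π), (A * cos θ) ^ l * B ^ (2 * m - l) * ((2 * m).choose l) =
      ((2 * m).choose l * ∫ θ in (0:ℝ)..(2 * π), cos θ ^ l) * (A ^ l * B ^ (2 * m - l)) := by
    intro l
    rw [← intervalIntegral.integral_const_mul, ← intervalIntegral.integral_mul_const]
    congr 1; ext θ; rw [mul_pow]; ring
  simp_rw [e]
  rw [hs m _ fun i => by rw [hodd]; ring]
  refine Finset.sum_congr rfl fun i _ => ?_
  rw [← pow_mul, ← pow_mul, Nat.mul_sub]

lemma integral_cos_pow_even_pos (m : ℕ) : 0 < ∫ θ in (0:ℝ)..(2 * π), cos θ ^ (2 * m) := by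
  refine intervalIntegral.integral_pos (by positivity) (by fun_prop)
    (fun x _ => by rw [pow_mul]; positivity) ⟨0, ⟨le_rfl, by positivity⟩, by simp⟩

/-- A point of the circle of radius `s` has an angle in `[0, 2π]`. -/
lemma exists_angle {x y s : ℝ} (hs : 0 ≤ s) (h : x ^ 2 + y ^ 2 = s ^ 2) :
    ∃ α ∈ Icc (0:ℝ) (2 * π), x = s * cos α ∧ y = s * sin α := by
  set z : ℂ := ⟨x, y⟩
  have hz : ‖z‖ = s := by
    rw [Complex.norm_def, Complex.normSq_apply, ← sqrt_sq hs, ← h]; ring_nf; rfl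
  have hx : x = s * cos z.arg := by rw [← hz, Complex.norm_mul_cos_arg]
  have hy : y = s * sin z.arg := by rw [← hz, Complex.norm_mul_sin_arg]
  rcases le_or_gt 0 z.arg with h0 | h0
  · exact ⟨z.arg, ⟨h0, by linarith [Complex.arg_le_pi z, pi_pos]⟩, hx, hy⟩
  · exact ⟨z.arg + 2 * π, ⟨by linarith [Complex.neg_pi_lt_arg z], by linarith⟩,
      by rwa [cos_add_two_pi], by rwa [sin_add_two_pi]⟩

lemma inner_sphVec (b : R3) (θ φ : ℝ) :
    inner ℝ b (sphVec θ φ) = b 0 * (sin φ * cos θ) + b 1 * (sin φ * sin θ) + b 2 * cos φ := by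
  simp [PiLp.inner_apply, Fin.sum_univ_three]; ring

lemma sum_sq_eq_one {b : R3} (hb : ‖b‖ = 1) : b 0 ^ 2 + b 1 ^ 2 + b 2 ^ 2 = 1 := by
  have := EuclideanSpace.real_norm_sq_eq b
  rw [hb, Fin.sum_univ_three] at this
  linarith

/-- The average of `⟪b, ·⟫ ^ (2m)` over a circle of colatitude `φ` is a polynomial of degree `m`
in `b₂²` whose leading coefficient does not vanish on the equator. -/
lemma exists_zonal_expansion (m : ℕ) :
    ∃ c : ℕ → Polynomial ℝ, (c m).coeff 0 ≠ 0 ∧ ∀ (φ : ℝ) (b : R3), ‖b‖ = 1 →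
      ∫ θ in (0:ℝ)..(2 * π), inner ℝ b (sphVec θ φ) ^ (2 * m) =
        ∑ j ∈ Finset.range (m + 1), (c j).eval (cos φ ^ 2) * b 2 ^ (2 * j) := by
  let k : ℕ → ℝ := fun i => (2 * m).choose (2 * i) * ∫ θ in (0:ℝ)..(2 * π), cos θ ^ (2 * i)
  let t : ℕ → Polynomial (Polynomial ℝ) := fun i =>
    Polynomial.C (Polynomial.C (k i) * (1 - Polynomial.X) ^ i * Polynomial.X ^ (m - i)) *
      (Polynomial.X ^ (m - i) * (1 - Polynomial.X) ^ i)
  let p : Polynomial (Polynomial ℝ) := ∑ i ∈ Finset.range (m + 1), t i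
  have h1X : (1 - Polynomial.X : Polynomial (Polynomial ℝ)).natDegree ≤ 1 := by
    compute_degree
  have hdeg : p.natDegree ≤ m := by
    refine Polynomial.natDegree_sum_le_of_forall_le _ _ fun i hi => ?_
    have hi' : i ≤ m := Nat.lt_succ_iff.1 (Finset.mem_range.1 hi)
    refine (Polynomial.natDegree_C_mul_le _ _).trans (Polynomial.natDegree_mul_le.trans ?_)
    have := Polynomial.natDegree_pow_le_of_le i h1X
    have h2 := Polynomial.natDegree_X_pow_le (R := Polynomial ℝ) (m - i)
    omega
  refine ⟨p.coeff, ?_, fun φ b hb => ?_⟩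
  · have hk : k m ≠ 0 := by
      simpa [k] using (integral_cos_pow_even_pos m).ne'
    rw [Polynomial.finsetSum_coeff, Polynomial.finsetSum_coeff, Finset.sum_range_succ,
      Finset.sum_eq_zero]
    · have := Polynomial.coeff_pow_of_natDegree_le (m := m) h1X
      simp only [mul_one] at this
      simp only [t, Polynomial.coeff_C_mul, Nat.sub_self, pow_zero, one_mul, mul_one, this]
      simp [Polynomial.coeff_zero_eq_eval_zero, Polynomial.coeff_one, hk]
    · intro i hi
      have hi' : m - i ≠ 0 := by have := Finset.mem_range.1 hi; omega
      simp only [t, Polynomial.coeff_C_mul, Polynomial.coeff_zero_eq_eval_zero,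
        Polynomial.eval_mul, Polynomial.eval_pow, Polynomial.eval_X, zero_pow hi', mul_zero,
        zero_mul]
  · have hb' := sum_sq_eq_one hb
    have hs : 0 ≤ 1 - b 2 ^ 2 := by nlinarith [sq_nonneg (b 0), sq_nonneg (b 1)]
    obtain ⟨α, -, h0, h1⟩ := exists_angle (x := b 0) (y := b 1) (sqrt_nonneg (1 - b 2 ^ 2))
      (by rw [sq_sqrt hs]; linarith)
    have e : ∀ θ, inner ℝ b (sphVec θ φ) ^ (2 * m) =
        (sin φ * √(1 - b 2 ^ 2) * cos (θ - α) + b 2 * cos φ) ^ (2 * m) := by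
      intro θ
      rw [inner_sphVec, h0, h1, cos_sub]; ring
    have hp : Function.Periodic
        (fun θ => (sin φ * √(1 - b 2 ^ 2) * cos θ + b 2 * cos φ) ^ (2 * m)) (2 * π) := by
      intro θ; simp
    simp_rw [e]
    rw [intervalIntegral.integral_comp_sub_right
      (fun θ => (sin φ * √(1 - b 2 ^ 2) * cos θ + b 2 * cos φ) ^ (2 * m)) α,
      show 2 * π - α = (0 - α) + 2 * π by ring, hp.intervalIntegral_add_eq (0 - α) 0, zero_add,
      integral_cos_add_pow]
    have hev : (p.map (Polynomial.evalRingHom (cos φ ^ 2))).eval (b 2 ^ 2) =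
        ∑ j ∈ Finset.range (m + 1), (p.coeff j).eval (cos φ ^ 2) * b 2 ^ (2 * j) := by
      rw [Polynomial.eval_eq_sum_range'
        (Nat.lt_succ_of_le (Polynomial.natDegree_map_le.trans hdeg))]
      simp [Polynomial.coeff_map, pow_mul]
    rw [← hev, Polynomial.map_sum, Polynomial.eval_finsetSum]
    refine Finset.sum_congr rfl fun i _ => ?_
    have hsin : sin φ ^ 2 = 1 - cos φ ^ 2 := by linarith [sin_sq_add_cos_sq φ]
    simp only [t, Polynomial.map_mul, Polynomial.map_C, Polynomial.map_pow, Polynomial.map_sub,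
      Polynomial.map_one, Polynomial.map_X, Polynomial.eval_mul, Polynomial.eval_C,
      Polynomial.eval_pow, Polynomial.eval_sub, Polynomial.eval_one, Polynomial.eval_X,
      Polynomial.coe_evalRingHom, mul_pow, sq_sqrt hs, hsin, k]
    ring

/-- The surface measure of the unit sphere, as a measure on `ℝ³`. -/
def sphereMeasure : Measure R3 :=
  (3 : ℝ≥0∞) • Measure.map (fun x => ‖x‖⁻¹ • x) (volume.restrict (Metric.ball 0 1))

lemma measurable_normalize : Measurable (fun x : R3 => ‖x‖⁻¹ • x) := by fun_prop

instance : IsFiniteMeasure sphereMeasure := by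
  have : IsFiniteMeasure (volume.restrict (Metric.ball (0 : R3) 1)) :=
    isFiniteMeasure_restrict.2 measure_ball_lt_top.ne
  have h2 : IsFiniteMeasure
      (Measure.map (fun x : R3 => ‖x‖⁻¹ • x) (volume.restrict (Metric.ball 0 1))) :=
    Measure.isFiniteMeasure_map _ _
  refine ⟨?_⟩
  rw [sphereMeasure, Measure.smul_apply, smul_eq_mul]
  exact ENNReal.mul_lt_top (by simp) (measure_lt_top _ _)

lemma sphereMeasure_restrict :
    sphereMeasure.restrict (Metric.sphere 0 1) = sphereMeasure := by
  refine Measure.restrict_eq_self_of_ae_mem ?_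
  rw [ae_iff]
  change sphereMeasure (Metric.sphere 0 1)ᶜ = 0
  rw [sphereMeasure, Measure.smul_apply, Measure.map_apply measurable_normalize
    Metric.isClosed_sphere.measurableSet.compl, smul_eq_mul, mul_eq_zero]
  right
  refine measure_mono_null (t := {0}) (fun x hx => ?_) (by simp)
  by_contra h
  refine hx ?_
  have : ‖x‖ ≠ 0 := by simpa using h
  simp [norm_smul, this]

lemma measurePreserving_sphereMeasure (h : R3 ≃ₗᵢ[ℝ] R3) :
    MeasurePreserving h sphereMeasure sphereMeasure := by
  refine ⟨h.continuous.measurable, ?_⟩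
  have h1 : MeasurePreserving h (volume.restrict (Metric.ball 0 1))
      (volume.restrict (Metric.ball 0 1)) := by
    have := h.measurePreserving.restrict_preimage (s := Metric.ball 0 1) measurableSet_ball
    simpa [LinearIsometryEquiv.preimage_ball] using this
  rw [sphereMeasure, Measure.map_smul, Measure.map_map h.continuous.measurable measurable_normalize]
  conv_rhs => rw [← h1.map_eq, Measure.map_map measurable_normalize h.continuous.measurable]
  congr 2
  ext1 x
  simp

lemma sphereMeasure_pos {u : Set R3} (hu : IsOpen u) {a : R3} (ha : ‖a‖ = 1) (hau : a ∈ u) :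
    0 < sphereMeasure u := by
  rw [sphereMeasure, Measure.smul_apply, Measure.map_apply measurable_normalize
    hu.measurableSet, smul_eq_mul,
    Measure.restrict_apply (measurable_normalize hu.measurableSet)]
  have hc : ContinuousOn (fun x : R3 => ‖x‖⁻¹ • x) {0}ᶜ :=
    (continuous_norm.continuousOn.inv₀ (by simp)).smul continuousOn_id
  have ho : IsOpen (({0}ᶜ ∩ (fun x : R3 => ‖x‖⁻¹ • x) ⁻¹' u) ∩ Metric.ball 0 1) :=
    (hc.isOpen_inter_preimage isOpen_compl_singleton hu).inter Metric.isOpen_ball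
  have hne : (({0}ᶜ ∩ (fun x : R3 => ‖x‖⁻¹ • x) ⁻¹' u) ∩ Metric.ball 0 1).Nonempty := by
    refine ⟨(1 / 2 : ℝ) • a, ⟨?_, ?_⟩, ?_⟩
    · have : a ≠ 0 := by rintro rfl; simp at ha
      simpa using this
    · simpa [norm_smul, ha, smul_smul] using hau
    · rw [mem_ball_zero_iff, norm_smul, ha]; norm_num
  refine ENNReal.mul_pos (by simp) (ne_of_gt ?_)
  exact (ho.measure_pos volume hne).trans_le
    (measure_mono (inter_subset_inter_left _ inter_subset_right))

/-- The angular density of the surface measure. -/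
def angleMeasure : Measure (ℝ × ℝ) :=
  ((volume.restrict (Ioo (-π) π)).prod (volume.restrict (Ioo 0 π))).withDensity
    fun p => ENNReal.ofReal (sin p.2)

lemma map_angleMeasure : angleMeasure.map (fun p => sphVec p.1 p.2) = sphereMeasure := by
  have hsm : Measurable (fun p : ℝ × ℝ => sphVec p.1 p.2) := sphVec_continuous.measurable
  refine Measure.ext fun A hA => ?_
  have hA' : Measurable (A.indicator (1 : R3 → ℝ≥0∞)) := measurable_one.indicator hA
  rw [Measure.map_apply hsm hA, ← lintegral_indicator_one (hsm hA), angleMeasure,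
    lintegral_withDensity_eq_lintegral_mul _ (by fun_prop)
      (measurable_one.indicator (hsm hA)), lintegral_prod _ ?_]
  swap
  · exact ((by fun_prop : Measurable fun p : ℝ × ℝ => ENNReal.ofReal (sin p.2)).mul
      (measurable_one.indicator (hsm hA))).aemeasurable
  rw [sphereMeasure, Measure.smul_apply, Measure.map_apply measurable_normalize hA, smul_eq_mul,
    Measure.restrict_apply (measurable_normalize hA),
    ← lintegral_indicator_one ((measurable_normalize hA).inter measurableSet_ball),
    lintegral_spherical _ (measurable_one.indicator
      ((measurable_normalize hA).inter measurableSet_ball)), ← lintegral_const_mul' _ _ (by simp)]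
  refine lintegral_congr fun θ => ?_
  have e : ∀ ρ ∈ Ioi (0:ℝ), ∫⁻ φ in Ioo 0 π, ENNReal.ofReal (ρ ^ 2 * sin φ) *
      (((fun x : R3 => ‖x‖⁻¹ • x) ⁻¹' A ∩ Metric.ball 0 1).indicator 1 (ρ • sphVec θ φ)) =
      (Iio (1:ℝ)).indicator (fun ρ => ENNReal.ofReal (ρ ^ 2)) ρ *
      ∫⁻ φ in Ioo 0 π, ENNReal.ofReal (sin φ) * A.indicator 1 (sphVec θ φ) := by
    intro ρ hρ
    have hρ' : (0:ℝ) < ρ := hρ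
    rw [← lintegral_const_mul' _ _ (by simp only [indicator]; split_ifs <;> simp)]
    refine lintegral_congr fun φ => ?_
    rw [← mul_assoc, ENNReal.ofReal_mul (by positivity)]
    have hn : ‖ρ • sphVec θ φ‖ = ρ := by
      rw [norm_smul, norm_sphVec, mul_one, norm_of_nonneg hρ'.le]
    have hv : ρ⁻¹ • ρ • sphVec θ φ = sphVec θ φ := by
      rw [smul_smul, inv_mul_cancel₀ hρ'.ne', one_smul]
    by_cases h1 : ρ < 1 <;> by_cases h2 : sphVec θ φ ∈ A <;> simp [indicator, hn, hv, h1, h2]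
  rw [setLIntegral_congr_fun measurableSet_Ioi e, lintegral_mul_const _
    ((by fun_prop : Measurable fun ρ : ℝ => ENNReal.ofReal (ρ ^ 2)).indicator measurableSet_Iio),
    lintegral_indicator measurableSet_Iio, Measure.restrict_restrict measurableSet_Iio,
    ← mul_assoc]
  have e3 : (3:ℝ≥0∞) * ∫⁻ ρ in Iio 1 ∩ Ioi (0:ℝ), ENNReal.ofReal (ρ ^ 2) = 1 := by
    rw [inter_comm, Ioi_inter_Iio, Measure.restrict_congr_set Ioo_ae_eq_Ioc,
      ← ofReal_integral_eq_lintegral_ofReal, ← intervalIntegral.integral_of_le zero_le_one,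
      integral_pow]
    · rw [show (3:ℝ≥0∞) = ENNReal.ofReal 3 by simp, ← ENNReal.ofReal_mul (by norm_num)]
      norm_num
    · exact (continuous_pow 2).integrableOn_Ioc
    · exact Filter.Eventually.of_forall fun x => by positivity
  rw [e3, one_mul]
  rfl

/-- Integration over the sphere in spherical coordinates, azimuth inside. -/
lemma integral_sphereMeasure {G : R3 → ℝ} (hG : Continuous G) :
    ∫ y, G y ∂sphereMeasure =
      ∫ φ in (0:ℝ)..π, ∫ θ in (0:ℝ)..(2 * π), sin φ * G (sphVec θ φ) := by
  rw [← map_angleMeasure, integral_map sphVec_continuous.aemeasurable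
    hG.aestronglyMeasurable, angleMeasure, integral_withDensity_eq_integral_toReal_smul
      (by fun_prop) (by simp)]
  have hc : Continuous fun p : ℝ × ℝ => sin p.2 * G (sphVec p.1 p.2) := by fun_prop
  have hi : Integrable (fun p : ℝ × ℝ => sin p.2 * G (sphVec p.1 p.2))
      ((volume.restrict (Ioo (-π) π)).prod (volume.restrict (Ioo 0 π))) := by
    rw [Measure.prod_restrict]
    exact (hc.continuousOn.integrableOn_compact (isCompact_Icc.prod isCompact_Icc)).mono_set
      (prod_mono Ioo_subset_Icc_self Ioo_subset_Icc_self)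
  have e : ∫ p, (ENNReal.ofReal (sin p.2)).toReal • G (sphVec p.1 p.2)
      ∂((volume.restrict (Ioo (-π) π)).prod (volume.restrict (Ioo 0 π))) =
      ∫ p, sin p.2 * G (sphVec p.1 p.2)
      ∂((volume.restrict (Ioo (-π) π)).prod (volume.restrict (Ioo 0 π))) := by
    rw [Measure.prod_restrict]
    refine setIntegral_congr_fun (measurableSet_Ioo.prod measurableSet_Ioo) fun p hp => ?_
    have : 0 ≤ sin p.2 := sin_nonneg_of_nonneg_of_le_pi hp.2.1.le hp.2.2.le
    simp [this]
  rw [e, integral_prod_symm _ hi, intervalIntegral.integral_of_le pi_pos.le,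
    integral_Ioc_eq_integral_Ioo]
  refine setIntegral_congr_fun measurableSet_Ioo fun φ _ => ?_
  have hp : Function.Periodic (fun θ => sin φ * G (sphVec θ φ)) (2 * π) := by
    intro θ; simp [sphVec]
  have := hp.intervalIntegral_add_eq (-π) 0
  simp only
  rw [zero_add, show -π + 2 * π = π by ring] at this
  rw [← this, intervalIntegral.integral_of_le (by linarith [pi_pos]), integral_Ioc_eq_integral_Ioo]

/-- Integration over the sphere in spherical coordinates, colatitude inside. -/
lemma integral_sphereMeasure' {G : R3 → ℝ} (hG : Continuous G) :
    ∫ y, G y ∂sphereMeasure =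
      ∫ θ in (0:ℝ)..(2 * π), ∫ φ in (0:ℝ)..π, sin φ * G (sphVec θ φ) := by
  rw [integral_sphereMeasure hG]
  refine intervalIntegral_intervalIntegral_swap ?_
  have hc : Continuous (Function.uncurry fun φ θ : ℝ => sin φ * G (sphVec θ φ)) := by
    unfold Function.uncurry
    fun_prop
  have hK : IsCompact (uIcc 0 π ×ˢ uIcc 0 (2 * π)) := isCompact_uIcc.prod isCompact_uIcc
  exact (hc.continuousOn.integrableOn_compact hK).mono_set
    (prod_mono uIoc_subset_uIcc uIoc_subset_uIcc)

/-- `U(α)V(β)` as a linear isometry of `ℝ³`. -/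
def rotUVIso (α β : ℝ) : R3 ≃ₗᵢ[ℝ] R3 :=
  LinearIsometry.toLinearIsometryEquiv
    { toFun := rotUV α β
      map_add' := fun x y => by
        ext i; fin_cases i <;> simp [rotUV, rotZ, rotY] <;> ring
      map_smul' := fun c x => by
        ext i; fin_cases i <;> simp [rotUV, rotZ, rotY] <;> ring
      norm_map' := fun x => by
        rw [← sq_eq_sq₀ (norm_nonneg _) (norm_nonneg _), EuclideanSpace.real_norm_sq_eq,
          EuclideanSpace.real_norm_sq_eq, Fin.sum_univ_three, Fin.sum_univ_three]
        simp only [LinearMap.coe_mk, AddHom.coe_mk, rotUV, rotZ, rotY, WithLp.equiv_symm_apply,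
          PiLp.toLp_apply, Matrix.cons_val_zero, Matrix.cons_val_one, Matrix.cons_val]
        have h1 := sin_sq_add_cos_sq α
        have h2 := sin_sq_add_cos_sq β
        linear_combination ((cos β * x 0 + sin β * x 2) ^ 2 + x 1 ^ 2) * h1 +
          (x 0 ^ 2 + x 2 ^ 2) * h2 }
    rfl

@[simp] lemma rotUVIso_apply (α β : ℝ) (x : R3) : rotUVIso α β x = rotUV α β x := rfl

lemma inner_pole (b : R3) : inner ℝ b (sphVec 0 0) = b 2 := by simp [inner_sphVec]

lemma rotUV_pole (α β : ℝ) : rotUV α β (sphVec 0 0) = sphVec α β := by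
  ext i; fin_cases i <;> simp [rotUV, rotZ, rotY, sphVec] <;> ring

lemma exists_rotUV {y : R3} (hy : ‖y‖ = 1) :
    ∃ α ∈ Icc (0:ℝ) (2 * π), ∃ β ∈ Icc (0:ℝ) π, rotUV α β (sphVec 0 0) = y := by
  have h := sum_sq_eq_one hy
  have hs : 0 ≤ 1 - y 2 ^ 2 := by nlinarith [sq_nonneg (y 0), sq_nonneg (y 1)]
  have h1 : y 2 ^ 2 ≤ 1 := by linarith
  rw [sq_le_one_iff_abs_le_one, abs_le] at h1
  obtain ⟨α, hα, h0, h1'⟩ := exists_angle (x := y 0) (y := y 1) (sqrt_nonneg (1 - y 2 ^ 2))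
    (by rw [sq_sqrt hs]; linarith)
  refine ⟨α, hα, arccos (y 2), ⟨arccos_nonneg _, arccos_le_pi _⟩, ?_⟩
  rw [rotUV_pole]
  ext i
  fin_cases i <;> simp [sin_arccos, h0, h1', cos_arccos h1.1 h1.2]

lemma integral_rot (h : R3 ≃ₗᵢ[ℝ] R3) (G : R3 → ℝ) :
    ∫ y, G (h y) ∂sphereMeasure = ∫ y, G y ∂sphereMeasure :=
  (measurePreserving_sphereMeasure h).integral_comp h.toHomeomorph.measurableEmbedding G

lemma integrable_sphereMeasure {G : R3 → ℝ} (hG : Continuous G) : Integrable G sphereMeasure := by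
  rw [← sphereMeasure_restrict]
  exact hG.continuousOn.integrableOn_compact (isCompact_sphere _ _)

lemma integral_sphereMeasure_congr {F G : R3 → ℝ} (h : ∀ y, ‖y‖ = 1 → F y = G y) :
    ∫ y, F y ∂sphereMeasure = ∫ y, G y ∂sphereMeasure := by
  rw [← sphereMeasure_restrict]
  exact setIntegral_congr_fun Metric.isClosed_sphere.measurableSet fun y hy =>
    h y (by simpa using hy)

lemma integral_sphereMeasure_swap {F : R3 → R3 → ℝ} (hF : Continuous (Function.uncurry F)) :
    ∫ x, ∫ y, F x y ∂sphereMeasure ∂sphereMeasure =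
      ∫ y, ∫ x, F x y ∂sphereMeasure ∂sphereMeasure := by
  refine integral_integral_swap ?_
  rw [← sphereMeasure_restrict, Measure.prod_restrict]
  exact hF.continuousOn.integrableOn_compact ((isCompact_sphere _ _).prod (isCompact_sphere _ _))

lemma intervalIntegral_sphereMeasure_swap {F : ℝ → R3 → ℝ} (hF : Continuous (Function.uncurry F))
    (a b : ℝ) :
    ∫ x in a..b, (∫ y, F x y ∂sphereMeasure) = ∫ y, (∫ x in a..b, F x y) ∂sphereMeasure := by
  refine intervalIntegral_integral_swap ?_
  rw [← sphereMeasure_restrict, Measure.prod_restrict]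
  exact (hF.continuousOn.integrableOn_compact
    (isCompact_uIcc.prod (isCompact_sphere _ _))).mono_set (prod_mono uIoc_subset_uIcc le_rfl)

lemma integral_lemon_eq {E : ℝ → R3 → ℝ} (hE : Continuous (Function.uncurry E)) (r : ℝ)
    (h : R3 ≃ₗᵢ[ℝ] R3) :
    ∫ y, E (r * √(1 - inner ℝ (h (sphVec 0 0)) y ^ 2)) y ∂sphereMeasure =
      ∫ θ in (0:ℝ)..(2 * π), ∫ φ in (0:ℝ)..π, sin φ * E (r * sin φ) (h (sphVec θ φ)) := by
  have hc : Continuous fun y => E (r * √(1 - inner ℝ (h (sphVec 0 0)) (h y) ^ 2)) (h y) :=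
    hE.comp (f := fun y => (r * √(1 - inner ℝ (h (sphVec 0 0)) (h y) ^ 2), h y)) (by fun_prop)
  rw [← integral_rot h, integral_sphereMeasure' hc]
  refine intervalIntegral.integral_congr fun θ _ => intervalIntegral.integral_congr fun φ hφ => ?_
  rw [uIcc_of_le pi_pos.le] at hφ
  simp only [LinearIsometryEquiv.inner_map_map]
  rw [real_inner_comm, inner_pole, sphVec_two, ← abs_sin_eq_sqrt_one_sub_cos_sq,
    abs_of_nonneg (sin_nonneg_of_mem_Icc hφ)]

/-- The `m`-th even zonal moment about `a` of the slices of `E`. -/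
def zonalMoment (E : ℝ → R3 → ℝ) (a : R3) (m : ℕ) (x : ℝ) : ℝ :=
  ∫ y, E x y * inner ℝ a y ^ (2 * m) ∂sphereMeasure

/-- Integrating the lemon integrals of `E` against `⟪a, ·⟫ ^ (2m)` gives an equation for
the zonal moments of `E` about `a`. -/
lemma integral_zonalMoment_eq {E : ℝ → R3 → ℝ} (hE : Continuous (Function.uncurry E)) {r : ℝ}
    (hr : ∀ n : R3, ‖n‖ = 1 → ∫ y, E (r * √(1 - inner ℝ n y ^ 2)) y ∂sphereMeasure = 0)
    {a : R3} (ha : ‖a‖ = 1) {m : ℕ} {c : ℕ → Polynomial ℝ}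
    (hc : ∀ (φ : ℝ) (b : R3), ‖b‖ = 1 →
      ∫ θ in (0:ℝ)..(2 * π), inner ℝ b (sphVec θ φ) ^ (2 * m) =
        ∑ j ∈ Finset.range (m + 1), (c j).eval (cos φ ^ 2) * b 2 ^ (2 * j)) :
    ∫ φ in (0:ℝ)..π, ∑ j ∈ Finset.range (m + 1),
      sin φ * (c j).eval (cos φ ^ 2) * zonalMoment E a j (r * sin φ) = 0 := by
  have hF : Continuous (Function.uncurry fun n y : R3 =>
      E (r * √(1 - inner ℝ n y ^ 2)) y * inner ℝ a n ^ (2 * m)) := by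
    unfold Function.uncurry
    exact (hE.comp (f := fun p : R3 × R3 => (r * √(1 - inner ℝ p.1 p.2 ^ 2), p.2))
      (by fun_prop)).mul (by fun_prop)
  have hG : Continuous (Function.uncurry fun (φ : ℝ) (y : R3) =>
      ∑ j ∈ Finset.range (m + 1),
        sin φ * (c j).eval (cos φ ^ 2) * (E (r * sin φ) y * inner ℝ a y ^ (2 * j))) := by
    unfold Function.uncurry
    refine continuous_finsetSum _ fun j _ => ?_
    exact (Continuous.mul (by fun_prop) (by fun_prop)).mul
      ((hE.comp (f := fun p : ℝ × R3 => (r * sin p.1, p.2)) (by fun_prop)).mul (by fun_prop))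
  have h0 : ∫ n, ∫ y, E (r * √(1 - inner ℝ n y ^ 2)) y * inner ℝ a n ^ (2 * m)
      ∂sphereMeasure ∂sphereMeasure = 0 := by
    rw [integral_sphereMeasure_congr (G := fun _ => 0), integral_zero]
    intro n hn
    rw [integral_mul_const, hr n hn, zero_mul]
  rw [integral_sphereMeasure_swap hF] at h0
  refine Eq.trans ?_ h0
  have e1 : ∀ φ, ∑ j ∈ Finset.range (m + 1),
      sin φ * (c j).eval (cos φ ^ 2) * zonalMoment E a j (r * sin φ) =
      ∫ y, ∑ j ∈ Finset.range (m + 1),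
        sin φ * (c j).eval (cos φ ^ 2) * (E (r * sin φ) y * inner ℝ a y ^ (2 * j))
        ∂sphereMeasure := by
    intro φ
    rw [integral_finsetSum]
    · simp_rw [integral_const_mul]; rfl
    · intro j _
      refine (integrable_sphereMeasure ?_).const_mul _
      exact (hE.comp (f := fun y : R3 => (r * sin φ, y)) (by fun_prop)).mul (by fun_prop)
  simp_rw [e1]
  rw [intervalIntegral_sphereMeasure_swap hG]
  refine integral_sphereMeasure_congr fun y hy => ?_
  obtain ⟨α, -, β, -, rfl⟩ := exists_rotUV hy
  set h := rotUVIso α β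
  set b := h.symm a
  have hab : h b = a := h.apply_symm_apply a
  have hb : ‖b‖ = 1 := by rw [← ha, ← hab, h.norm_map]
  have hy' : rotUV α β (sphVec 0 0) = h (sphVec 0 0) := rfl
  rw [hy', ← integral_rot h (fun x =>
    E (r * √(1 - inner ℝ x (h (sphVec 0 0)) ^ 2)) (h (sphVec 0 0)) * inner ℝ a x ^ (2 * m))]
  symm
  simp_rw [← hab, h.inner_map_map, inner_pole]
  rw [integral_sphereMeasure]
  swap
  · have hc' : Continuous fun n : R3 => E (r * √(1 - n 2 ^ 2)) (h (sphVec 0 0)) :=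
      hE.comp (f := fun n : R3 => (r * √(1 - n 2 ^ 2), h (sphVec 0 0))) (by fun_prop)
    exact hc'.mul (by fun_prop)
  refine intervalIntegral.integral_congr fun φ hφ => ?_
  rw [uIcc_of_le pi_pos.le] at hφ
  simp only [sphVec_two]
  rw [intervalIntegral.integral_const_mul, intervalIntegral.integral_const_mul, hc φ b hb,
    ← abs_sin_eq_sqrt_one_sub_cos_sq, abs_of_nonneg (sin_nonneg_of_mem_Icc hφ), Finset.mul_sum,
    Finset.mul_sum]
  exact Finset.sum_congr rfl fun j _ => by ring

open Filter Topology

/-- Differentiation under the integral sign over a compact set. -/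
lemma hasDerivAt_setIntegral_of_isCompact {T : Type*} [MetricSpace T] [SecondCountableTopology T]
    [MeasurableSpace T] [BorelSpace T] {μ : Measure T} [IsFiniteMeasureOnCompacts μ] {K : Set T}
    (hK : IsCompact K) {F F' : ℝ → T → ℝ} (hF : Continuous (Function.uncurry F))
    (hF' : Continuous (Function.uncurry F')) (h : ∀ x t, HasDerivAt (fun x => F x t) (F' x t) x)
    (x₀ : ℝ) :
    HasDerivAt (fun x => ∫ t in K, F x t ∂μ) (∫ t in K, F' x₀ t ∂μ) x₀ := by
  have hc : ∀ x, Continuous (F x) := fun x => hF.comp (f := fun t => (x, t)) (by fun_prop)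
  have hc' : ∀ x, Continuous (F' x) := fun x => hF'.comp (f := fun t => (x, t)) (by fun_prop)
  obtain ⟨C, hC⟩ := ((isCompact_closedBall x₀ 1).prod hK).exists_bound_of_continuousOn
    hF'.continuousOn
  refine (hasDerivAt_integral_of_dominated_loc_of_deriv_le (bound := fun _ => C)
    (Metric.ball_mem_nhds x₀ one_pos) (Eventually.of_forall fun x =>
      (hc x).aestronglyMeasurable) ((hc x₀).continuousOn.integrableOn_compact hK)
    (hc' x₀).aestronglyMeasurable ?_ ?_ (Eventually.of_forall fun t x _ => h x t)).2
  · refine ae_restrict_of_forall_mem hK.measurableSet fun t ht x hx => ?_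
    exact hC (x, t) ⟨Metric.ball_subset_closedBall hx, ht⟩
  · exact integrableOn_const hK.measure_lt_top.ne

/-- The integrals `∫ sin φ (cos φ)^{2i} g(r sin φ) dφ` over `[0, π]`. -/
def abelMoment (g : ℝ → ℝ) (i : ℕ) (r : ℝ) : ℝ :=
  ∫ φ in (0:ℝ)..π, sin φ * cos φ ^ (2 * i) * g (r * sin φ)

lemma hasDerivAt_abelMoment {g g' : ℝ → ℝ} (hg : ∀ x, HasDerivAt g (g' x) x) (hg' : Continuous g')
    (i : ℕ) (r : ℝ) :
    HasDerivAt (abelMoment g i)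
      (∫ φ in (0:ℝ)..π, sin φ * cos φ ^ (2 * i) * (g' (r * sin φ) * sin φ)) r := by
  have hgc : Continuous g := continuous_iff_continuousAt.2 fun x => (hg x).continuousAt
  have := hasDerivAt_setIntegral_of_isCompact (μ := volume) (isCompact_Icc (a := 0) (b := π))
    (F := fun r φ => sin φ * cos φ ^ (2 * i) * g (r * sin φ))
    (F' := fun r φ => sin φ * cos φ ^ (2 * i) * (g' (r * sin φ) * sin φ))
    (by unfold Function.uncurry; fun_prop) (by unfold Function.uncurry; fun_prop)
    (fun r φ => ((hg (r * sin φ)).comp r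
      (by simpa using (hasDerivAt_id r).mul_const (sin φ))).const_mul _) r
  change HasDerivAt (fun r => ∫ φ in (0:ℝ)..π, sin φ * cos φ ^ (2 * i) * g (r * sin φ)) _ r
  simpa only [integral_Icc_eq_integral_Ioc, ← intervalIntegral.integral_of_le pi_pos.le] using this

lemma hasDerivAt_pow_mul_abelMoment {g g' : ℝ → ℝ} (hg : ∀ x, HasDerivAt g (g' x) x)
    (hg' : Continuous g') (i : ℕ) (r : ℝ) :
    HasDerivAt (fun r => r ^ (2 * i + 3) * abelMoment g (i + 1) r)
      ((2 * i + 1) * r * (r ^ (2 * i + 1) * abelMoment g i r)) r := by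
  have hgc : Continuous g := continuous_iff_continuousAt.2 fun x => (hg x).continuousAt
  have h := (hasDerivAt_pow (2 * i + 3) r).mul (hasDerivAt_abelMoment hg hg' (i + 1) r)
  refine h.congr_deriv ?_
  have hW : ∀ φ, HasDerivAt (fun φ => sin φ ^ 2 * cos φ ^ (2 * i + 1) * g (r * sin φ))
      ((2 * sin φ * cos φ ^ (2 * i + 2) - (2 * i + 1) * sin φ ^ 3 * cos φ ^ (2 * i)) * g (r * sin φ)
        + sin φ ^ 2 * cos φ ^ (2 * i + 1) * (g' (r * sin φ) * (r * cos φ))) φ := by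
    intro φ
    have h1 := ((hasDerivAt_sin φ).pow 2).mul ((hasDerivAt_cos φ).pow (2 * i + 1))
    have h2 := (hg (r * sin φ)).comp φ ((hasDerivAt_sin φ).const_mul r)
    refine (h1.mul h2).congr_deriv ?_
    simp only [Pi.mul_apply, Pi.pow_apply, Function.comp_apply, Nat.add_sub_cancel]
    push_cast
    ring
  have hI := intervalIntegral.integral_eq_sub_of_hasDerivAt (a := 0) (b := π) (fun φ _ => hW φ)
    (Continuous.intervalIntegrable (by fun_prop) _ _)
  simp only [sin_pi, sin_zero, ne_eq, OfNat.ofNat_ne_zero, not_false_eq_true, zero_pow, zero_mul,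
    sub_zero] at hI
  have key : (2 * i + 3) * abelMoment g (i + 1) r +
      r * (∫ φ in (0:ℝ)..π, sin φ * cos φ ^ (2 * (i + 1)) * (g' (r * sin φ) * sin φ)) -
      (2 * i + 1) * abelMoment g i r = 0 := by
    refine Eq.trans ?_ hI
    rw [abelMoment, abelMoment, ← intervalIntegral.integral_const_mul,
      ← intervalIntegral.integral_const_mul, ← intervalIntegral.integral_const_mul,
      ← intervalIntegral.integral_add (Continuous.intervalIntegrable (by fun_prop) _ _)
        (Continuous.intervalIntegrable (by fun_prop) _ _),
      ← intervalIntegral.integral_sub (Continuous.intervalIntegrable (by fun_prop) _ _)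
        (Continuous.intervalIntegrable (by fun_prop) _ _)]
    congr 1
    ext φ
    linear_combination ((2 * i + 1) * sin φ * cos φ ^ (2 * i) * g (r * sin φ)) *
      sin_sq_add_cos_sq φ
  push_cast
  linear_combination r ^ (2 * i + 2) * key

lemma abelMoment_eq_zero_of_le {g : ℝ → ℝ} {x₀ : ℝ} (h0 : ∀ x ∈ Icc 0 x₀, g x = 0) (i : ℕ)
    {r : ℝ} (hr : r ∈ Icc 0 x₀) : abelMoment g i r = 0 := by
  rw [abelMoment, intervalIntegral.integral_congr (g := fun _ => 0), intervalIntegral.integral_zero]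
  intro φ hφ
  rw [uIcc_of_le pi_pos.le] at hφ
  have hs := sin_nonneg_of_mem_Icc hφ
  have hs1 := sin_le_one φ
  simp only
  rw [h0 _ ⟨mul_nonneg hr.1 hs, (mul_le_of_le_one_right hr.1 hs1).trans hr.2⟩, mul_zero]

/-- A Volterra equation with kernel `q(cos² φ)`, `q(0) ≠ 0`, reduces to `abelMoment g 0 = 0`. -/
lemma abelMoment_zero_eq_zero {g g' : ℝ → ℝ} (hg : ∀ x, HasDerivAt g (g' x) x)
    (hg' : Continuous g') {x₀ : ℝ} (hx₀ : 0 < x₀) (h0 : ∀ x ∈ Icc 0 x₀, g x = 0)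
    {q : Polynomial ℝ} (hq : q.coeff 0 ≠ 0) {δ : ℝ}
    (h : ∀ r ∈ Icc 0 δ, ∫ φ in (0:ℝ)..π, sin φ * q.eval (cos φ ^ 2) * g (r * sin φ) = 0) :
    ∀ r ∈ Icc 0 δ, abelMoment g 0 r = 0 := by
  have hgc : Continuous g := continuous_iff_continuousAt.2 fun x => (hg x).continuousAt
  intro r hr
  rcases le_or_gt r x₀ with hrx | hrx
  · exact abelMoment_eq_zero_of_le h0 0 ⟨hr.1, hrx⟩
  set M := q.natDegree
  have hsum : ∀ r ∈ Icc 0 δ, q.coeff 0 * abelMoment g 0 r =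
      - ∑ i ∈ Finset.range M, q.coeff (i + 1) * abelMoment g (i + 1) r := by
    intro r hr
    rw [eq_neg_iff_add_eq_zero, add_comm,
      ← Finset.sum_range_succ' (fun i => q.coeff i * abelMoment g i r), ← h r hr]
    simp_rw [abelMoment, ← intervalIntegral.integral_const_mul]
    rw [← intervalIntegral.integral_finsetSum fun i _ =>
      Continuous.intervalIntegrable (by fun_prop) _ _]
    congr 1
    ext φ
    rw [Polynomial.eval_eq_sum_range, Finset.mul_sum, Finset.sum_mul]
    refine Finset.sum_congr rfl fun i _ => ?_
    rw [pow_mul]; ring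
  let V : ℝ → Fin M → ℝ := fun r k => r ^ (2 * (k : ℕ) + 3) * abelMoment g (k + 1) r
  let V' : ℝ → Fin M → ℝ := fun r k =>
    (2 * (k : ℕ) + 1) * r * (r ^ (2 * (k : ℕ) + 1) * abelMoment g k r)
  have hV : ∀ r, HasDerivAt V (V' r) r := fun r =>
    hasDerivAt_pi.2 fun k => hasDerivAt_pow_mul_abelMoment hg hg' k r
  have hA : ∀ r, 0 < r → ∀ i (hi : i < M),
      |abelMoment g (i + 1) r| ≤ ‖V r‖ / r ^ (2 * i + 3) := by
    intro r hr i hi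
    rw [le_div_iff₀ (by positivity)]
    calc |abelMoment g (i + 1) r| * r ^ (2 * i + 3) = ‖V r ⟨i, hi⟩‖ := by
          simp only [V, norm_mul, norm_pow, Real.norm_eq_abs, abs_of_pos hr]; ring
      _ ≤ ‖V r‖ := norm_le_pi_norm _ _
  set C := |q.coeff 0|⁻¹ * ∑ i ∈ Finset.range M, |q.coeff (i + 1)| / x₀ ^ (2 * i + 3)
  have hC : 0 ≤ C := by positivity
  have hA0 : ∀ r ∈ Icc x₀ δ, |abelMoment g 0 r| ≤ C * ‖V r‖ := by
    intro r hr
    have hr0 : 0 < r := hx₀.trans_le hr.1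
    have h1 := congrArg abs (hsum r ⟨hr0.le, hr.2⟩)
    rw [abs_mul, abs_neg] at h1
    have h2 : |∑ i ∈ Finset.range M, q.coeff (i + 1) * abelMoment g (i + 1) r| ≤
        (∑ i ∈ Finset.range M, |q.coeff (i + 1)| / x₀ ^ (2 * i + 3)) * ‖V r‖ := by
      rw [Finset.sum_mul]
      refine (Finset.abs_sum_le_sum_abs _ _).trans (Finset.sum_le_sum fun i hi => ?_)
      rw [abs_mul, div_mul_eq_mul_div, mul_div_assoc]
      refine mul_le_mul_of_nonneg_left ((hA r hr0 i (Finset.mem_range.1 hi)).trans ?_)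
        (abs_nonneg _)
      have := hr.1
      gcongr
    rw [← h1] at h2
    have hq' : 0 < |q.coeff 0| := abs_pos.2 hq
    rw [mul_assoc, inv_mul_eq_div, le_div_iff₀ hq']
    linarith
  have hδ : 0 < δ := hx₀.trans (hrx.trans_le hr.2)
  set L := (2 * M + 1) * δ * (1 + δ * C)
  have hbound : ∀ r ∈ Ico x₀ δ, ‖V' r‖ ≤ L * ‖V r‖ + 0 := by
    intro r hr
    have hr0 : 0 < r := hx₀.trans_le hr.1
    rw [add_zero]
    refine (pi_norm_le_iff_of_nonneg (by positivity)).2 fun k => ?_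
    have hk : r ^ (2 * (k : ℕ) + 1) * |abelMoment g k r| ≤ (1 + δ * C) * ‖V r‖ := by
      obtain ⟨k, hk⟩ := k
      rcases k with _ | k
      · have := hA0 r ⟨hr.1, hr.2.le⟩
        have h3 : r * |abelMoment g 0 r| ≤ δ * (C * ‖V r‖) :=
          mul_le_mul hr.2.le this (abs_nonneg _) hδ.le
        simp only [mul_zero, zero_add, pow_one]
        nlinarith [norm_nonneg (V r)]
      · have := hA r hr0 k (by omega)
        rw [le_div_iff₀ (by positivity)] at this
        have h3 : 0 ≤ δ * C * ‖V r‖ := by positivity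
        have e : 2 * (k + 1) + 1 = 2 * k + 3 := by ring
        simp only [e]
        nlinarith
    have hk2 : (2 * ((k : ℕ) : ℝ) + 1) * r ≤ (2 * M + 1) * δ := by
      have : ((k : ℕ) : ℝ) ≤ M := by exact_mod_cast k.2.le
      have := hr.2.le
      gcongr
    calc ‖V' r k‖
        = ((2 * ((k : ℕ) : ℝ) + 1) * r) * (r ^ (2 * (k : ℕ) + 1) * |abelMoment g k r|) := by
          simp only [V', norm_mul, Real.norm_eq_abs, abs_pow, abs_of_pos hr0]
          rw [abs_of_pos (by positivity)]
      _ ≤ ((2 * M + 1) * δ) * ((1 + δ * C) * ‖V r‖) :=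
          mul_le_mul hk2 hk (by positivity) (by positivity)
      _ = L * ‖V r‖ := by ring
  have hVx₀ : V x₀ = 0 := by
    ext k
    simp [V, abelMoment_eq_zero_of_le h0 _ (right_mem_Icc.2 hx₀.le)]
  have hVr := norm_le_gronwallBound_of_norm_deriv_right_le (a := x₀) (b := δ) (δ := 0)
    (fun r _ => (hV r).continuousAt.continuousWithinAt) (fun r _ => (hV r).hasDerivWithinAt)
    (by simp [hVx₀]) hbound r ⟨hrx.le, hr.2⟩
  rw [gronwallBound_ε0_δ0] at hVr
  have := hA0 r ⟨hrx.le, hr.2⟩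
  have h4 : ‖V r‖ = 0 := le_antisymm hVr (norm_nonneg _)
  rw [h4, mul_zero] at this
  exact abs_nonpos_iff.1 this

/-- Abel inversion: if `abelMoment g 0` vanishes on `[0, δ]`, so does `g`. Averaging over the
sphere reduces this to the vanishing of the primitive of `g`. -/
lemma eq_zero_of_abelMoment_zero {g : ℝ → ℝ} (hg : Continuous g) {δ : ℝ} (hg0 : g 0 = 0)
    (h : ∀ r ∈ Icc 0 δ, abelMoment g 0 r = 0) : ∀ x ∈ Icc 0 δ, g x = 0 := by
  have hprim : ∀ R ∈ Ioo 0 δ, ∫ u in (0:ℝ)..R, g u = 0 := by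
    intro R hR
    obtain ⟨α, -, β, -, hαβ⟩ := exists_rotUV (norm_sphVec (π / 2) (π / 2))
    have hn : ∀ z : R3, inner ℝ (sphVec (π / 2) (π / 2)) z = z 1 := fun z => by
      rw [real_inner_comm, inner_sphVec]; simp
    have hrot : ∀ y : R3, rotUVIso α β y 1 = y 2 := fun y => by
      rw [← hn, ← hαβ, ← rotUVIso_apply, LinearIsometryEquiv.inner_map_map, real_inner_comm,
        inner_pole]
    have h1 : ∫ y : R3, g (R * |y 1|) ∂sphereMeasure = 0 := by
      rw [integral_sphereMeasure' (G := fun y => g (R * |y 1|)) (by fun_prop)]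
      refine (intervalIntegral.integral_congr fun θ _ => ?_).trans intervalIntegral.integral_zero
      refine Eq.trans ?_ (h (R * |sin θ|) ⟨by have := hR.1; positivity,
        (mul_le_of_le_one_right hR.1.le (abs_sin_le_one θ)).trans hR.2.le⟩)
      refine intervalIntegral.integral_congr fun φ hφ => ?_
      rw [uIcc_of_le pi_pos.le] at hφ
      simp [abs_mul, abs_of_nonneg (sin_nonneg_of_mem_Icc hφ), mul_assoc, mul_comm]
    have h2 : ∫ φ in (0:ℝ)..π, sin φ * g (R * |cos φ|) = 0 := by
      have e := integral_rot (rotUVIso α β) (fun y => g (R * |y 1|))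
      simp only [hrot] at e
      rw [h1, integral_sphereMeasure (G := fun y => g (R * |y 2|)) (by fun_prop)] at e
      have e' : 2 * π * ∫ φ in (0:ℝ)..π, sin φ * g (R * |cos φ|) = 0 := by
        rw [← intervalIntegral.integral_const_mul]
        simpa [mul_left_comm] using e
      exact (mul_eq_zero.1 e').resolve_left two_pi_pos.ne'
    have h3 : ∫ u in (-1:ℝ)..1, g (R * |u|) = 0 := by
      have := intervalIntegral.integral_comp_mul_deriv (a := 0) (b := π) (f := cos)
        (f' := fun x => -sin x) (g := fun u => g (R * |u|)) (fun x _ => hasDerivAt_cos x)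
        (by fun_prop) (by fun_prop)
      simp only [Function.comp_apply, mul_neg, intervalIntegral.integral_neg, cos_zero, cos_pi]
        at this
      rw [intervalIntegral.integral_symm, ← this, neg_neg]
      refine Eq.trans ?_ h2
      simp_rw [mul_comm]
    have h4 : ∫ u in (0:ℝ)..1, g (R * |u|) = ∫ u in (0:ℝ)..1, g (R * u) :=
      intervalIntegral.integral_congr fun u hu => by
        rw [uIcc_of_le zero_le_one] at hu
        simp only [abs_of_nonneg hu.1]
    have h5 := intervalIntegral.integral_comp_neg (a := 0) (b := 1) fun u => g (R * |u|)
    simp only [abs_neg, neg_zero] at h5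
    rw [← intervalIntegral.integral_add_adjacent_intervals (b := 0)
      (Continuous.intervalIntegrable (by fun_prop) _ _)
      (Continuous.intervalIntegrable (by fun_prop) _ _), ← h5, h4,
      intervalIntegral.integral_comp_mul_left _ hR.1.ne', mul_zero, mul_one, smul_eq_mul,
      ← two_mul] at h3
    have := hR.1.ne'
    simpa [this] using h3
  have hIoo : ∀ x ∈ Ioo 0 δ, g x = 0 := fun x hx =>
    (hg.integral_hasStrictDerivAt 0 x).hasDerivAt.unique <|
      (hasDerivAt_const x (0:ℝ)).congr_of_eventuallyEq <|
        eventually_of_mem (isOpen_Ioo.mem_nhds hx) hprim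
  intro x hx
  rcases hx.1.eq_or_lt with rfl | hx0
  · exact hg0
  · have hs : closure (Ioo 0 δ) ⊆ g ⁻¹' {0} :=
      closure_minimal hIoo (isClosed_singleton.preimage hg)
    rw [closure_Ioo (hx0.trans_le hx.2).ne] at hs
    exact hs hx

/-- A continuous function on the upper hemisphere all of whose even zonal moments about `a` vanish
is zero at `a`. -/
lemma eq_zero_of_zonal_moments {e : R3 → ℝ} (he : Continuous e) (he0 : ∀ y : R3, y 2 ≤ 0 → e y = 0)
    {a : R3} (ha : ‖a‖ = 1) (ha2 : 0 < a 2)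
    (h : ∀ m : ℕ, ∫ y, e y * inner ℝ a y ^ (2 * m) ∂sphereMeasure = 0) : e a = 0 := by
  have hc2 : Continuous fun y : R3 => y 2 := by fun_prop
  have hH : IsClosed {y : R3 | 0 ≤ y 2} := isClosed_le continuous_const hc2
  set s : Set R3 := {y : R3 | 0 ≤ y 2} ∩ Metric.sphere 0 1
  have hs : IsCompact s := (isCompact_sphere _ _).inter_left hH
  have haa : inner ℝ a a = (1:ℝ) := by rw [real_inner_self_eq_norm_sq, ha, one_pow]
  have has : a ∈ s := ⟨ha2.le, by simpa using ha⟩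
  have hμ : ∀ u, IsOpen u → a ∈ u → 0 < sphereMeasure (u ∩ s) := by
    intro u hu hau
    have ho : IsOpen (u ∩ {y : R3 | 0 < y 2}) := hu.inter (isOpen_lt continuous_const hc2)
    have := sphereMeasure_pos ho ha ⟨hau, ha2⟩
    rw [← sphereMeasure_restrict, Measure.restrict_apply ho.measurableSet] at this
    refine this.trans_le (measure_mono fun y hy =>
      ⟨hy.1.1, show 0 ≤ y 2 from le_of_lt hy.1.2, hy.2⟩)
  have hmax : ∀ y ∈ s, y ≠ a → (inner ℝ a y : ℝ) ^ 2 < inner ℝ a a ^ 2 := by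
    intro y hy hya
    have hy1 : ‖y‖ = 1 := by simpa using hy.2
    rw [haa, one_pow, sq_lt_one_iff_abs_lt_one, abs_lt]
    constructor
    · have : -y ≠ a := by
        rintro rfl
        have : 0 ≤ y 2 := hy.1
        rw [PiLp.neg_apply] at ha2
        linarith
      have := (inner_lt_one_iff_real_of_norm_eq_one ha (by rwa [norm_neg] : ‖-y‖ = 1)).2 this.symm
      rw [inner_neg_right] at this
      linarith
    · exact (inner_lt_one_iff_real_of_norm_eq_one ha hy1).2 hya.symm
  have ht := tendsto_setIntegral_pow_smul_of_unique_maximum_of_isCompact_of_measure_nhdsWithin_pos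
    (g := e) hs hμ (c := fun y => inner ℝ a y ^ 2) (by fun_prop) hmax (fun _ _ => sq_nonneg _)
    (by rw [haa]; norm_num) has (he.continuousOn.integrableOn_compact hs)
    he.continuousWithinAt
  refine tendsto_nhds_unique ht (tendsto_const_nhds.congr fun m => ?_)
  rw [← Measure.restrict_restrict hH.measurableSet, sphereMeasure_restrict,
    setIntegral_eq_integral_of_forall_compl_eq_zero (f := fun y => (inner ℝ a y ^ 2) ^ m • e y)]
  · simp_rw [smul_eq_mul, ← pow_mul, mul_comm _ (e _), h, mul_zero]
  · intro y hy
    rw [he0 y (not_le.1 hy).le, smul_zero]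

/-- Injectivity of the family of lemon integrals of `E`, up to the parameter `δ`. -/
lemma eq_zero_of_lemon_integrals {E : ℝ → R3 → ℝ} (hE : ContDiff ℝ 1 (Function.uncurry E))
    (hE2 : ∀ x, ∀ y : R3, y 2 ≤ 0 → E x y = 0) {x₀ : ℝ} (hx₀ : 0 < x₀)
    (hE0 : ∀ x ∈ Icc 0 x₀, ∀ y : R3, ‖y‖ = 1 → E x y = 0) {δ : ℝ}
    (h : ∀ r ∈ Icc 0 δ, ∀ n : R3, ‖n‖ = 1 →
      ∫ y, E (r * √(1 - inner ℝ n y ^ 2)) y ∂sphereMeasure = 0)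
    {x : ℝ} (hx : x ∈ Icc 0 δ) {a : R3} (ha : ‖a‖ = 1) : E x a = 0 := by
  rcases le_or_gt (a 2) 0 with ha2 | ha2
  · exact hE2 x a ha2
  have hEc := hE.continuous
  have hEx : ∀ x, Continuous (E x) := fun x => hEc.comp (f := fun y => (x, y)) (by fun_prop)
  let F' : ℝ → R3 → ℝ := fun x y => fderiv ℝ (Function.uncurry E) (x, y) (1, 0)
  have hF' : Continuous (Function.uncurry F') :=
    (hE.continuous_fderiv one_ne_zero).clm_apply continuous_const
  have hF : ∀ x y, HasDerivAt (fun x => E x y) (F' x y) x := fun x y =>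
    (hE.differentiable one_ne_zero (x, y)).hasFDerivAt.comp_hasDerivAt (f := fun t => (t, y)) x
      ((hasDerivAt_id' x).prodMk (hasDerivAt_const x y))
  have hF'm : ∀ m : ℕ, Continuous (Function.uncurry fun x y => F' x y * inner ℝ a y ^ (2 * m)) :=
    fun m => hF'.mul (by fun_prop)
  have hd : ∀ m x, HasDerivAt (zonalMoment E a m)
      (∫ y in Metric.sphere 0 1, F' x y * inner ℝ a y ^ (2 * m) ∂sphereMeasure) x := by
    intro m x
    have := hasDerivAt_setIntegral_of_isCompact (μ := sphereMeasure)
      (isCompact_sphere (0 : R3) 1) (F := fun x y => E x y * inner ℝ a y ^ (2 * m))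
      (hEc.mul (by fun_prop)) (hF'm m)
      (fun x y => (hF x y).mul_const _) x
    change HasDerivAt (fun x => ∫ y, E x y * inner ℝ a y ^ (2 * m) ∂sphereMeasure) _ x
    simpa only [sphereMeasure_restrict] using this
  have hd' : ∀ m, Continuous fun x =>
      ∫ y in Metric.sphere 0 1, F' x y * inner ℝ a y ^ (2 * m) ∂sphereMeasure := fun m =>
    continuous_parametric_integral_of_continuous (hF'm m) (isCompact_sphere _ _)
  have hz0 : ∀ m, ∀ x ∈ Icc 0 x₀, zonalMoment E a m x = 0 := fun m x hx => by
    rw [zonalMoment, integral_sphereMeasure_congr (G := fun _ => 0), integral_zero]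
    intro y hy
    rw [hE0 x hx y hy, zero_mul]
  have hz : ∀ m, ∀ x ∈ Icc 0 δ, zonalMoment E a m x = 0 := by
    intro m
    induction m using Nat.strong_induction_on with
    | _ m ih =>
      obtain ⟨c, hc0, hc⟩ := exists_zonal_expansion m
      have hcont : Continuous (zonalMoment E a m) :=
        continuous_iff_continuousAt.2 fun x => (hd m x).continuousAt
      refine eq_zero_of_abelMoment_zero hcont (hz0 m 0 ⟨le_rfl, hx₀.le⟩) <|
        abelMoment_zero_eq_zero (hd m) (hd' m) hx₀ (hz0 m) hc0 fun r hr => ?_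
      refine Eq.trans ?_ (integral_zonalMoment_eq hEc (h r hr) ha hc)
      refine intervalIntegral.integral_congr fun φ hφ => ?_
      rw [uIcc_of_le pi_pos.le] at hφ
      have hs := sin_nonneg_of_mem_Icc hφ
      rw [Finset.sum_range_succ, Finset.sum_eq_zero, zero_add]
      intro j hj
      rw [ih j (Finset.mem_range.1 hj) _ ⟨mul_nonneg hr.1 hs,
        (mul_le_of_le_one_right hr.1 (sin_le_one φ)).trans hr.2⟩, mul_zero]
  exact eq_zero_of_zonal_moments (hEx x) (hE2 x) ha ha2 fun m => hz m x hx

lemma sqrt_sub_self_pos (x : ℝ) : 0 < √(x ^ 2 + 1) - x := by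
  have : |x| < √(x ^ 2 + 1) := by
    rw [← sqrt_sq_eq_abs]
    exact sqrt_lt_sqrt (sq_nonneg x) (lt_add_one _)
  linarith [le_abs_self x]

lemma sqrt_sub_self_apply {t : ℝ} (ht : 0 < t) :
    √(((1 - t ^ 2) / (2 * t)) ^ 2 + 1) - (1 - t ^ 2) / (2 * t) = t := by
  have : ((1 - t ^ 2) / (2 * t)) ^ 2 + 1 = ((1 + t ^ 2) / (2 * t)) ^ 2 := by field_simp; ring
  rw [this, sqrt_sq (by positivity)]
  field_simp
  ring

lemma sqrt_sub_self_antitone : Antitone fun x : ℝ => √(x ^ 2 + 1) - x := by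
  intro x y hxy
  have hx := sqrt_sub_self_pos x
  have hy := sqrt_sub_self_pos y
  have h1 := sq_sqrt (by positivity : 0 ≤ x ^ 2 + 1)
  have h2 := sq_sqrt (by positivity : 0 ≤ y ^ 2 + 1)
  simp only
  by_contra! hlt
  nlinarith [sqrt_nonneg (x ^ 2 + 1), sqrt_nonneg (y ^ 2 + 1)]

/-- The integrand of the spindle transform as a function of `x = r sin φ` and of the direction. -/
def lemonDensity (f : R3 → ℝ) (x : ℝ) (y : R3) : ℝ :=
  (√(x ^ 2 + 1) - x) ^ 2 / √(x ^ 2 + 1) * f ((√(x ^ 2 + 1) - x) • y)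

lemma contDiff_lemonDensity {f : R3 → ℝ} (hf : ContDiff ℝ 1 f) :
    ContDiff ℝ 1 (Function.uncurry (lemonDensity f)) := by
  have hs : ContDiff ℝ 1 fun p : ℝ × R3 => √(p.1 ^ 2 + 1) :=
    ((contDiff_fst.pow 2).add contDiff_const).sqrt fun p => by positivity
  have hρ := hs.sub contDiff_fst
  exact ((hρ.pow 2).div hs fun p => by positivity).mul (hf.comp (hρ.smul contDiff_snd))

lemma spindleT_eq {f : R3 → ℝ} (r α β : ℝ) :
    spindleT f r α β = √(1 + r ^ 2) * ∫ θ in (0:ℝ)..(2 * π), ∫ φ in (0:ℝ)..π,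
      sin φ * lemonDensity f (r * sin φ) (rotUV α β (sphVec θ φ)) := by
  simp_rw [spindleT, ← intervalIntegral.integral_const_mul]
  refine intervalIntegral.integral_congr fun θ _ => intervalIntegral.integral_congr fun φ _ => ?_
  simp only [lemonDensity, mul_pow]
  rw [sqrt_div (by positivity), add_comm (1 : ℝ) (r ^ 2 * _)]
  ring

/-- Corollary 1 of the paper: the spindle transform on `0 ≤ r ≤ δ`
determines a smooth function supported in `B_{ε₁,ε₂} ∩ U` uniquely for `ε ≤ |x| ≤ 1`. -/
theorem spindle_transform_determines
    (ε₁ ε₂ : ℝ) (hε₁ : 0 < ε₁) (h₁₂ : ε₁ < ε₂) (hε₂ : ε₂ < 1)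
    (f : R3 → ℝ) (hf : ContDiff ℝ (⊤ : ℕ∞) f) (hfc : HasCompactSupport f)
    (hsupp : tsupport f ⊆ hollowBall ε₁ ε₂ ∩ upperHalf)
    (ε : ℝ) (hε : ε₁ ≤ ε ∧ ε ≤ ε₂) (δ : ℝ) (hδ : δ = (1 - ε ^ 2) / (2 * ε))
    (hS : ∀ r ∈ Icc (0:ℝ) δ, ∀ α ∈ Icc (0:ℝ) (2 * π), ∀ β ∈ Icc (0:ℝ) π,
      spindleT f r α β = 0) :
    ∀ x : R3, ε ≤ ‖x‖ → ‖x‖ ≤ 1 → f x = 0 := by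
  obtain ⟨hε1, hε2⟩ := hε
  have hε₂0 : 0 < ε₂ := hε₁.trans h₁₂
  have hε0 : 0 < ε := hε₁.trans_le hε1
  have hf2 : ∀ y : R3, y 2 ≤ 0 → f y = 0 := fun y hy => by
    by_contra hne
    exact (hsupp (subset_tsupport f hne)).2.not_ge hy
  have hfε₂ : ∀ y : R3, ε₂ ≤ ‖y‖ → f y = 0 := fun y hy => by
    by_contra hne
    exact (hsupp (subset_tsupport f hne)).1.2.not_ge hy
  intro x hx hx1
  have hx0 : 0 < ‖x‖ := hε0.trans_le hx
  have ha : ‖‖x‖⁻¹ • x‖ = 1 := by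
    rw [norm_smul, norm_inv, norm_norm, inv_mul_cancel₀ hx0.ne']
  have hzero : lemonDensity f ((1 - ‖x‖ ^ 2) / (2 * ‖x‖)) (‖x‖⁻¹ • x) = 0 := by
    refine eq_zero_of_lemon_integrals (contDiff_lemonDensity (hf.of_le (by simp))) ?_
      (x₀ := (1 - ε₂ ^ 2) / (2 * ε₂)) (div_pos (by nlinarith) (by positivity)) ?_ (δ := δ) ?_ ?_ ha
    · intro t y hy
      rw [lemonDensity, hf2, mul_zero]
      exact mul_nonpos_of_nonneg_of_nonpos (sqrt_sub_self_pos t).le hy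
    · intro t ht y hy
      rw [lemonDensity, hfε₂, mul_zero]
      rw [norm_smul, hy, mul_one, norm_of_nonneg (sqrt_sub_self_pos t).le]
      simpa only [sqrt_sub_self_apply hε₂0] using sqrt_sub_self_antitone ht.2
    · intro r hr n hn
      obtain ⟨α, hα, β, hβ, rfl⟩ := exists_rotUV hn
      have := hS r hr α hα β hβ
      rw [spindleT_eq] at this
      have hc := (contDiff_lemonDensity (hf.of_le (by simp) : ContDiff ℝ 1 f)).continuous
      have e := integral_lemon_eq hc r (rotUVIso α β)
      simp only [rotUVIso_apply] at e
      rw [e]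
      exact (mul_eq_zero.1 this).resolve_left (by positivity)
    · have := pow_le_one₀ (n := 2) hx0.le hx1
      refine ⟨div_nonneg (by linarith) (by positivity), ?_⟩
      rw [hδ]
      gcongr
      nlinarith
  rw [lemonDensity, sqrt_sub_self_apply hx0, smul_smul, mul_inv_cancel₀ hx0.ne', one_smul] at hzero
  exact (mul_eq_zero.1 hzero).resolve_left (by positivity)
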